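/- Let C be a projective 16-divisible binary linear code of effective length 131 and dimension k, with weight distribution a_i and with a₃* the number of weight-3 vectors in the dual code C^⊥. Then (as integers) a₄₈ = −6·a₁₆ − 3·a₃₂ − 10 + 11·2^(k−9), a₆₄ = 8·a₁₆ + 3·a₃₂ + 15 + 221·2^(k−8), a₈₀ = −3·a₁₆ − a₃₂ − 6 + 59·2^(k−9), 2^k · a₃* = 2^17·a₁₆ + 2^15·a₃₂ − 311·2^k + 5·2^16, k ≥ 9, and a₈₀ ≥ 4 + 3·2^(k−5) ≥ 52. -/

import Mathlib

/-- Hamming weight of a binary vector. -/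
def hwt {n : ℕ} (c : Fin n → ZMod 2) : ℕ :=
  (Finset.univ.filter fun i => c i ≠ 0).card

/-- The number of codewords of weight `i` in the code `C`. -/
noncomputable def weightCount {n : ℕ} (C : Submodule (ZMod 2) (Fin n → ZMod 2)) (i : ℕ) : ℕ :=
  Set.ncard {c : Fin n → ZMod 2 | c ∈ C ∧ hwt c = i}

/-- The number of weight-`i` vectors in the dual code of `C`. -/
noncomputable def dualWeightCount {n : ℕ} (C : Submodule (ZMod 2) (Fin n → ZMod 2)) (i : ℕ) : ℕ :=
  Set.ncard {x : Fin n → ZMod 2 | (∀ c ∈ C, ∑ j, x j * c j = 0) ∧ hwt x = i}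

noncomputable section
open Classical

/-- Sign character. -/
def chi (x : ZMod 2) : ℤ := if x = 0 then 1 else -1

theorem chi_add : ∀ x y : ZMod 2, chi (x + y) = chi x * chi y := by
  unfold chi; decide

theorem chi_eq (x : ZMod 2) : chi x = 1 - 2 * (if x ≠ 0 then 1 else 0) := by
  unfold chi; split_ifs <;> simp_all

instance instFinC {n : ℕ} (C : Submodule (ZMod 2) (Fin n → ZMod 2)) : Fintype C :=
  Fintype.ofFinite C

theorem card_C {n : ℕ} (C : Submodule (ZMod 2) (Fin n → ZMod 2)) :
    Fintype.card C = 2 ^ Module.finrank (ZMod 2) C := by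
  have := Module.card_eq_pow_finrank (K := ZMod 2) (V := C)
  simpa using this

theorem orth {n : ℕ} (C : Submodule (ZMod 2) (Fin n → ZMod 2))
    (f : (Fin n → ZMod 2) →ₗ[ZMod 2] ZMod 2) (h : ∃ c ∈ C, f c ≠ 0) :
    ∑ c : C, chi (f c) = 0 := by
  obtain ⟨c0, h0, hf⟩ := h
  have h1 : ∑ c : C, chi (f c) = ∑ c : C, chi (f ((c + ⟨c0, h0⟩ : C) : Fin n → ZMod 2)) :=
    (Equiv.sum_comp (Equiv.addRight (⟨c0, h0⟩ : C)) (fun c : C => chi (f c))).symm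
  have h2 : chi (f c0) = -1 := by simp [chi, hf]
  simp only [Submodule.coe_add, map_add, chi_add, h2, ← Finset.sum_mul] at h1
  linarith

def SS {n : ℕ} (Z : Finset (Fin n)) (c : Fin n → ZMod 2) : ℤ := ∑ i ∈ Z, chi (c i)

theorem SS_eq {n : ℕ} (Z : Finset (Fin n)) (c : Fin n → ZMod 2) :
    SS Z c = Z.card - 2 * ((Z.filter fun i => c i ≠ 0).card : ℤ) := by
  unfold SS
  simp only [chi_eq, Finset.sum_sub_distrib, ← Finset.mul_sum, Finset.sum_boole]
  simp

theorem mom1 {n : ℕ} (C : Submodule (ZMod 2) (Fin n → ZMod 2))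
    (heff : ∀ i : Fin n, ∃ c ∈ C, c i ≠ 0) (Z : Finset (Fin n)) :
    ∑ c : C, SS Z c = 0 := by
  unfold SS
  rw [Finset.sum_comm]
  refine Finset.sum_eq_zero fun i _ => ?_
  exact orth C (LinearMap.proj i) (heff i)

theorem ne_add : ∀ x y : ZMod 2, x ≠ y → x + y ≠ 0 := by decide

theorem mom2 {n : ℕ} (C : Submodule (ZMod 2) (Fin n → ZMod 2))
    (hproj : ∀ i j : Fin n, i ≠ j → ∃ c ∈ C, c i ≠ c j) (Z : Finset (Fin n)) :
    ∑ c : C, SS Z c ^ 2 = Fintype.card C * Z.card := by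
  have h : ∀ i j : Fin n, ∑ c : C, chi (c.1 i) * chi (c.1 j) =
      if i = j then (Fintype.card C : ℤ) else 0 := by
    intro i j
    simp only [← chi_add]
    split_ifs with hij
    · subst hij
      have : ∀ x : ZMod 2, chi (x + x) = 1 := by unfold chi; decide
      simp [this]
    · obtain ⟨c, hc, hne⟩ := hproj i j hij
      exact orth C ((LinearMap.proj i : (Fin n → ZMod 2) →ₗ[ZMod 2] ZMod 2) + LinearMap.proj j) ⟨c, hc, by
        simpa using ne_add _ _ hne⟩
  unfold SS
  simp only [sq, Finset.sum_mul_sum]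
  rw [Finset.sum_comm]
  rw [Finset.sum_congr rfl (fun i _ => Finset.sum_comm)]
  simp only [h]
  simp [mul_comm]

theorem mom3 {n : ℕ} (C : Submodule (ZMod 2) (Fin n → ZMod 2)) :
    ∑ c : C, SS Finset.univ c.1 ^ 3 = Fintype.card C *
      ((Finset.univ.filter fun t : Fin n × Fin n × Fin n =>
        ∀ c ∈ C, c t.1 + c t.2.1 + c t.2.2 = 0).card : ℤ) := by
  have h : ∀ t : Fin n × Fin n × Fin n,
      ∑ c : C, chi (c.1 t.1 + c.1 t.2.1 + c.1 t.2.2) =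
      if (∀ c ∈ C, c t.1 + c t.2.1 + c t.2.2 = 0) then (Fintype.card C : ℤ) else 0 := by
    intro t
    split_ifs with hh
    · have : ∀ c : C, chi (c.1 t.1 + c.1 t.2.1 + c.1 t.2.2) = 1 := by
        intro c; rw [hh c.1 c.2]; rfl
      simp [this]
    · push Not at hh
      exact orth C ((LinearMap.proj t.1 : (Fin n → ZMod 2) →ₗ[ZMod 2] ZMod 2) + LinearMap.proj t.2.1 + LinearMap.proj t.2.2) (by simpa using hh)
  have h3 : ∀ c : C, SS Finset.univ c.1 ^ 3 =
      ∑ t : Fin n × Fin n × Fin n, chi (c.1 t.1 + c.1 t.2.1 + c.1 t.2.2) := by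
    intro c
    simp only [chi_add, Fintype.sum_prod_type, ← Finset.mul_sum, ← Finset.sum_mul, SS]
    ring
  simp only [h3]
  rw [Finset.sum_comm]
  simp only [h, ← Finset.sum_filter]
  simp [mul_comm]

def vec {n : ℕ} (t : Fin n × Fin n × Fin n) : Fin n → ZMod 2 :=
  Pi.single t.1 1 + Pi.single t.2.1 1 + Pi.single t.2.2 1

theorem vec_sum {n : ℕ} (t : Fin n × Fin n × Fin n) (c : Fin n → ZMod 2) :
    ∑ j, vec t j * c j = c t.1 + c t.2.1 + c t.2.2 := by
  simp [vec, add_mul, Finset.sum_add_distrib, Pi.single_apply]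

theorem vec_supp {n : ℕ} (a b c : Fin n) (hab : a ≠ b) (hac : a ≠ c) (hbc : b ≠ c) (i : Fin n) :
    vec (a, b, c) i = if (i = a ∨ i = b ∨ i = c) then 1 else 0 := by
  simp only [vec, Pi.add_apply, Pi.single_apply]
  by_cases h1 : i = a <;> by_cases h2 : i = b <;> by_cases h3 : i = c <;> simp_all

theorem count3 {n : ℕ} (C : Submodule (ZMod 2) (Fin n → ZMod 2))
    (heff : ∀ i : Fin n, ∃ c ∈ C, c i ≠ 0) :
    (Finset.univ.filter fun t : Fin n × Fin n × Fin n =>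
        ∀ c ∈ C, c t.1 + c t.2.1 + c t.2.2 = 0).card = 6 * dualWeightCount C 3 := by
  have hd : dualWeightCount C 3 = (Finset.univ.filter fun x : Fin n → ZMod 2 =>
      (∀ c ∈ C, ∑ j, x j * c j = 0) ∧ hwt x = 3).card := by
    unfold dualWeightCount
    rw [← Set.ncard_coe_finset]
    simp
  have hdist : ∀ t : Fin n × Fin n × Fin n, (∀ c ∈ C, c t.1 + c t.2.1 + c t.2.2 = 0) →
      t.1 ≠ t.2.1 ∧ t.1 ≠ t.2.2 ∧ t.2.1 ≠ t.2.2 := by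
    have e1 : ∀ x y : ZMod 2, x + x + y = 0 → y = 0 := by decide
    have e2 : ∀ x y : ZMod 2, x + y + x = 0 → y = 0 := by decide
    have e3 : ∀ x y : ZMod 2, y + x + x = 0 → y = 0 := by decide
    rintro ⟨a, b, d⟩ ht
    refine ⟨?_, ?_, ?_⟩ <;> rintro h <;> simp only at h ht <;> subst h
    · obtain ⟨c, hc, hne⟩ := heff d
      exact hne (e1 _ _ (ht c hc))
    · obtain ⟨c, hc, hne⟩ := heff b
      exact hne (e2 _ _ (ht c hc))
    · obtain ⟨c, hc, hne⟩ := heff a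
      exact hne (e3 _ _ (ht c hc))
  rw [hd, mul_comm, ← smul_eq_mul, ← Finset.sum_const]
  rw [Finset.card_eq_sum_card_fiberwise (f := vec) (t := Finset.univ.filter fun x : Fin n → ZMod 2 =>
      (∀ c ∈ C, ∑ j, x j * c j = 0) ∧ hwt x = 3)]
  · refine Finset.sum_congr rfl fun x hx => ?_
    simp only [Finset.mem_filter, Finset.mem_univ, true_and] at hx
    obtain ⟨hx1, hx2⟩ := hx
    obtain ⟨a, b, d, hab, had, hbd, hS⟩ := Finset.card_eq_three.mp hx2
    have hxi : ∀ i, x i ≠ 0 ↔ (i = a ∨ i = b ∨ i = d) := by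
      intro i
      have := Finset.ext_iff.mp hS i
      simpa using this
    have hdec : ∀ y : ZMod 2, y ≠ 0 → y = 1 := by decide
    have hvec : ∀ p q r : Fin n, p ≠ q → p ≠ r → q ≠ r →
        (vec (p, q, r) = x ↔ ∀ i, (i = p ∨ i = q ∨ i = r) ↔ (i = a ∨ i = b ∨ i = d)) := by
      intro p q r h1 h2 h3
      rw [funext_iff]
      refine forall_congr' fun i => ?_
      rw [vec_supp p q r h1 h2 h3, ← hxi]
      split_ifs with h
      · simp only [h, true_iff]
        exact ⟨fun h => by rw [← h]; decide, fun h => (hdec _ h).symm⟩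
      · simp only [h, false_iff, not_not]
        exact eq_comm
    have hset : (Finset.filter (fun t => vec t = x) (Finset.univ.filter
        fun t : Fin n × Fin n × Fin n => ∀ c ∈ C, c t.1 + c t.2.1 + c t.2.2 = 0)) =
        {(a, b, d), (a, d, b), (b, a, d), (b, d, a), (d, a, b), (d, b, a)} := by
      ext ⟨p, q, r⟩
      simp only [Finset.mem_filter, Finset.mem_univ, true_and, Finset.mem_insert,
        Finset.mem_singleton, Prod.mk.injEq]
      constructor
      · rintro ⟨h1, h2⟩
        obtain ⟨g1, g2, g3⟩ := hdist (p, q, r) h1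
        simp only at g1 g2 g3
        have h4 := (hvec p q r g1 g2 g3).mp h2
        have := h4 p
        have := h4 q
        have := h4 r
        grind
      · intro h
        have hne : p ≠ q ∧ p ≠ r ∧ q ≠ r := by grind
        have hv : vec (p, q, r) = x := by
          rw [hvec p q r hne.1 hne.2.1 hne.2.2]
          intro i
          grind
        refine ⟨fun c hc => ?_, hv⟩
        have := hx1 c hc
        rw [← hv, vec_sum] at this
        exact this
    rw [hset]
    have := hab.symm
    have := had.symm
    have := hbd.symm
    simp [*]
  · intro t ht
    simp only [Finset.coe_filter, Finset.mem_univ, true_and, Set.mem_ofPred_eq] at ht ⊢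
    refine ⟨fun c hc => by rw [vec_sum]; exact ht c hc, ?_⟩
    obtain ⟨g1, g2, g3⟩ := hdist _ ht
    obtain ⟨a, b, d⟩ := t
    simp only at g1 g2 g3
    unfold hwt
    rw [Finset.card_eq_three]
    refine ⟨a, b, d, g1, g2, g3, ?_⟩
    ext i
    simp [vec_supp a b d g1 g2 g3]
    tauto

theorem res_wt {n : ℕ} (c d : Fin n → ZMod 2) :
    hwt d + hwt (c + d) =
      2 * ((Finset.univ.filter fun i => c i = 0).filter fun i => d i ≠ 0).card + hwt c := by
  unfold hwt
  rw [Finset.filter_filter]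
  simp only [Finset.card_filter, Finset.mul_sum, ← Finset.sum_add_distrib]
  refine Finset.sum_congr rfl fun i _ => ?_
  have : ∀ x y : ZMod 2, ((if y ≠ 0 then 1 else 0) + (if x + y ≠ 0 then 1 else 0) : ℕ) =
    2 * (if x = 0 ∧ y ≠ 0 then 1 else 0) + (if x ≠ 0 then 1 else 0) := by decide
  simpa using this (c i) (d i)

theorem excl {n : ℕ} (C : Submodule (ZMod 2) (Fin n → ZMod 2))
    (heff : ∀ i : Fin n, ∃ c ∈ C, c i ≠ 0)
    (hproj : ∀ i j : Fin n, i ≠ j → ∃ c ∈ C, c i ≠ c j)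
    (hdiv : ∀ c ∈ C, 16 ∣ hwt c) (c : Fin n → ZMod 2) (hc : c ∈ C) (t : ℕ) (ht : t ≤ 2)
    (hw : hwt c + (16 * t + 3) = n) : False := by
  set Z : Finset (Fin n) := Finset.univ.filter fun i => c i = 0 with hZ
  have hcard : Z.card = 16 * t + 3 := by
    have := Finset.card_filter_add_card_filter_not (s := (Finset.univ : Finset (Fin n)))
      (fun i => c i = 0)
    simp only [Finset.card_univ, Fintype.card_fin] at this
    change Z.card + hwt c = n at this
    omega
  have h1 := mom1 C heff Z
  have h2 := mom2 C hproj Z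
  have hpos : (0 : ℤ) < Fintype.card C := by
    exact_mod_cast Fintype.card_pos
  have hsum : ∑ d : C, (3 - SS Z d) * (-13 - SS Z d) = Fintype.card C * (Z.card - 39) := by
    have : ∀ d : C, (3 - SS Z d) * (-13 - SS Z d) = SS Z d ^ 2 + 10 * SS Z d - 39 := by
      intro d; ring
    simp only [this, Finset.sum_sub_distrib, Finset.sum_add_distrib, ← Finset.mul_sum, h1, h2]
    simp
    ring
  have hnn : 0 ≤ ∑ d : C, (3 - SS Z d) * (-13 - SS Z d) := by
    refine Finset.sum_nonneg fun d _ => ?_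
    have hr := res_wt c d.1
    have e1 := hdiv _ d.2
    have e2 := hdiv _ hc
    have e3 := hdiv _ (C.add_mem hc d.2)
    rw [SS_eq, hcard]
    rw [← hZ] at hr
    set v := (Z.filter fun i => d.1 i ≠ 0).card
    obtain ⟨u, hu⟩ : 8 ∣ v := by omega
    rw [hu]
    push_cast
    rcases le_or_gt u t with h | h
    · have : (u : ℤ) ≤ t := by exact_mod_cast h
      nlinarith
    · have : (t : ℤ) + 1 ≤ u := by exact_mod_cast h
      nlinarith
  rw [hsum, hcard] at hnn
  have : (t : ℤ) ≤ 2 := by exact_mod_cast ht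
  push_cast at hnn
  nlinarith

theorem wc_eq {n : ℕ} (C : Submodule (ZMod 2) (Fin n → ZMod 2)) (w : ℕ) :
    weightCount C w = (Finset.univ.filter fun c : C => hwt c.1 = w).card := by
  unfold weightCount
  rw [← Set.ncard_coe_finset, ← Set.ncard_image_of_injective _ Subtype.val_injective]
  congr 1
  ext x
  simp [and_comm]

theorem hwt_zero_iff {n : ℕ} (c : Fin n → ZMod 2) : hwt c = 0 ↔ c = 0 := by
  unfold hwt
  rw [Finset.card_eq_zero, Finset.filter_eq_empty_iff, funext_iff]
  simp

theorem arith (k : ℕ) (A B D E F G : ℤ) (hA0 : 0 ≤ A) (hB0 : 0 ≤ B) (hD0 : 0 ≤ D)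
    (m0 : 2 ^ k = 1 + A + B + D + E + F)
    (m1 : 0 = 131 + A * 99 + B * 67 + D * 35 + E * 3 + F * (-29))
    (m2 : 2 ^ k * 131 = 131 ^ 2 + A * 99 ^ 2 + B * 67 ^ 2 + D * 35 ^ 2 + E * 3 ^ 2 + F * (-29) ^ 2)
    (m3 : 2 ^ k * (6 * G) =
      131 ^ 3 + A * 99 ^ 3 + B * 67 ^ 3 + D * 35 ^ 3 + E * 3 ^ 3 + F * (-29) ^ 3) :
    D = -6 * A - 3 * B - 10 + 11 * 2 ^ (k - 9) ∧
    E = 8 * A + 3 * B + 15 + 221 * 2 ^ (k - 8) ∧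
    F = -3 * A - B - 6 + 59 * 2 ^ (k - 9) ∧
    (2 : ℤ) ^ k * G = 2 ^ 17 * A + 2 ^ 15 * B - 311 * 2 ^ k + 5 * 2 ^ 16 ∧
    9 ≤ k ∧ F ≥ 4 + 3 * 2 ^ (k - 5) ∧ (4 + 3 * 2 ^ (k - 5) : ℤ) ≥ 52 := by
  have q : 512 * (D + 6 * A + 3 * B + 10) = 11 * 2 ^ k := by linarith
  have hk9 : 9 ≤ k := by
    by_contra hlt
    have : k ≤ 8 := by omega
    interval_cases k <;> omega
  obtain ⟨r, rfl⟩ := Nat.exists_eq_add_of_le hk9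
  have r9 : 9 + r - 9 = r := by omega
  have r8 : 9 + r - 8 = r + 1 := by omega
  have r5 : 9 + r - 5 = r + 4 := by omega
  rw [r9, r8, r5]
  have hp : (1 : ℤ) ≤ 2 ^ r := one_le_pow₀ (by norm_num)
  simp only [pow_add] at *
  norm_num at *
  generalize (2 : ℤ) ^ r = P at *
  refine ⟨?_, ?_, ?_, ?_, ?_, ?_⟩ <;> linarith

end

theorem general_information (C : Submodule (ZMod 2) (Fin 131 → ZMod 2)) (k : ℕ)
    (hk : Module.finrank (ZMod 2) C = k)
    (heff : ∀ i : Fin 131, ∃ c ∈ C, c i ≠ 0)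
    (hproj : ∀ i j : Fin 131, i ≠ j → ∃ c ∈ C, c i ≠ c j)
    (hdiv : ∀ c ∈ C, 16 ∣ hwt c) :
    (weightCount C 48 : ℤ) =
        -6 * weightCount C 16 - 3 * weightCount C 32 - 10 + 11 * 2 ^ (k - 9) ∧
    (weightCount C 64 : ℤ) =
        8 * weightCount C 16 + 3 * weightCount C 32 + 15 + 221 * 2 ^ (k - 8) ∧
    (weightCount C 80 : ℤ) =
        -3 * weightCount C 16 - weightCount C 32 - 6 + 59 * 2 ^ (k - 9) ∧
    (2 : ℤ) ^ k * dualWeightCount C 3 =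
        2 ^ 17 * weightCount C 16 + 2 ^ 15 * weightCount C 32 - 311 * 2 ^ k + 5 * 2 ^ 16 ∧
    9 ≤ k ∧
    (weightCount C 80 : ℤ) ≥ 4 + 3 * 2 ^ (k - 5) ∧
    (4 + 3 * 2 ^ (k - 5) : ℤ) ≥ 52 := by
  have hw : ∀ c : C, hwt c.1 ∈ ({0, 16, 32, 48, 64, 80} : Finset ℕ) := by
    intro c
    have h1 := hdiv _ c.2
    have h2 : hwt c.1 ≤ 131 := by
      have := Finset.card_le_univ (Finset.univ.filter fun i => c.1 i ≠ 0)
      simpa [hwt] using this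
    have h3 := excl C heff hproj hdiv c.1 c.2
    have e0 : ¬ (hwt c.1 + (16 * 0 + 3) = 131) := h3 0 (by norm_num)
    have e1 : ¬ (hwt c.1 + (16 * 1 + 3) = 131) := h3 1 (by norm_num)
    have e2 : ¬ (hwt c.1 + (16 * 2 + 3) = 131) := h3 2 (by norm_num)
    simp only [Finset.mem_insert, Finset.mem_singleton]
    omega
  have h0 : weightCount C 0 = 1 := by
    unfold weightCount
    rw [Set.ncard_eq_one]
    refine ⟨0, ?_⟩
    ext x
    simp only [hwt_zero_iff, Set.mem_ofPred_eq, Set.mem_singleton_iff]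
    exact ⟨fun h => h.2, fun h => ⟨h ▸ C.zero_mem, h⟩⟩
  have key : ∀ g : ℤ → ℤ, ∑ c : C, g (SS Finset.univ c.1) =
      g 131 + weightCount C 16 * g 99 + weightCount C 32 * g 67 + weightCount C 48 * g 35
       + weightCount C 64 * g 3 + weightCount C 80 * g (-29) := by
    intro g
    rw [← Finset.sum_fiberwise_of_maps_to (fun c _ => hw c)]
    have : ∀ w : ℕ, ∑ c : C with hwt c.1 = w, g (SS Finset.univ c.1) =
        weightCount C w * g (131 - 2 * w) := by
      intro w
      rw [wc_eq, ← nsmul_eq_mul, ← Finset.sum_const]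
      refine Finset.sum_congr rfl fun c hc => ?_
      simp only [Finset.mem_filter, Finset.mem_univ, true_and] at hc
      rw [SS_eq]
      change g (_ - 2 * (hwt c.1 : ℤ)) = _
      rw [hc]
      simp
    simp only [this]
    simp [h0]
    ring
  have hcard := card_C C
  rw [hk] at hcard
  have m0 := key (fun _ => 1)
  have m1 := key (fun x => x)
  have m2 := key (fun x => x ^ 2)
  have m3 := key (fun x => x ^ 3)
  rw [mom1 C heff] at m1
  rw [mom2 C hproj] at m2
  rw [mom3 C, count3 C heff] at m3
  simp only [Finset.sum_const, Finset.card_univ, nsmul_eq_mul, hcard, Fintype.card_fin] at m0 m2 m3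
  push_cast at m0 m1 m2 m3
  exact arith k _ _ _ _ _ _ (Int.natCast_nonneg _) (Int.natCast_nonneg _) (Int.natCast_nonneg _)
    (by linarith) (by linarith) (by linarith) (by linarith)
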